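/- Let n ≥ 2, let u, w ≥ 0 be integers and v ∈ ℤ with v ≠ 0, and assume that if n divides v then u·w = 0. If x ∈ L_v satisfies |η_{u,v,w}(x)| ≤ |η_{u,v,w}(y)| for all y ∈ L_v, then η_{u,v,w}(x) is a geodesic word: the word length of the element t^{-u} a^{v} t^{w} of BS(1,n) equals |η_{u,v,w}(x)|. -/

import Mathlib

abbrev Letter : Type := Fin 2 × Bool

def bsRels (n : ℕ) : Set (FreeGroup (Fin 2)) :=
  {FreeGroup.of 1 * FreeGroup.of 0 * (FreeGroup.of 1)⁻¹ * (FreeGroup.of 0 ^ n)⁻¹}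

abbrev BS (n : ℕ) : Type := PresentedGroup (bsRels n)

def bsA (n : ℕ) : BS n := PresentedGroup.of 0

def bsT (n : ℕ) : BS n := PresentedGroup.of 1

def evalLetter (n : ℕ) (l : Letter) : BS n :=
  cond l.2 (if l.1 = 0 then bsA n else bsT n) (if l.1 = 0 then (bsA n)⁻¹ else (bsT n)⁻¹)

def evalWord (n : ℕ) (wd : List Letter) : BS n := (wd.map (evalLetter n)).prod

noncomputable def wordLength (n : ℕ) (g : BS n) : ℕ :=
  sInf {N : ℕ | ∃ wd : List Letter, evalWord n wd = g ∧ wd.length = N}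

def bsSphere (n N : ℕ) : Set (BS n) := {g : BS n | wordLength n g = N}

def sigmaD (n : ℕ) (x : ℕ →₀ ℤ) : ℤ := x.sum fun i c => c * (n : ℤ) ^ i

def l1D (x : ℕ →₀ ℤ) : ℕ := x.sum fun _ c => c.natAbs

def kIdx (x : ℕ →₀ ℤ) : ℕ := x.support.sup id

noncomputable def wVec (n i : ℕ) : ℕ →₀ ℤ := Finsupp.single i (-(n : ℤ)) + Finsupp.single (i + 1) 1

def etaLen (u w : ℕ) (x : ℕ →₀ ℤ) : ℕ :=
  if kIdx x ≤ w ∨ u ≤ w then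
    u + l1D x + kIdx x + ((w : ℤ) - kIdx x).natAbs
  else
    ((kIdx x : ℤ) - u).natAbs + l1D x + kIdx x + w

def BoxSet (n u w : ℕ) (v : ℤ) : Set (ℕ →₀ ℤ) :=
  {x | sigmaD n x = v ∧
    (∀ i < kIdx x, |x i| ≤ ((n / 2 : ℕ) : ℤ)) ∧
    (kIdx x < max u w → |x (kIdx x)| ≤ ((n / 2 : ℕ) : ℤ)) ∧
    (max u w ≤ kIdx x → |x (kIdx x)| ≤ ((n / 2 : ℕ) : ℤ) + if n = 2 then 2 else 1)}

def absLexLE (x y : ℕ →₀ ℤ) : Prop :=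
  (∀ i, |x i| = |y i|) ∨ ∃ i : ℕ, (∀ j < i, |x j| = |y j|) ∧ |x i| < |y i|

def IsMinimalVec (n u w : ℕ) (x : ℕ →₀ ℤ) : Prop :=
  (∀ y : ℕ →₀ ℤ, sigmaD n y = sigmaD n x → etaLen u w x ≤ etaLen u w y) ∧
  (Even n → ∀ y : ℕ →₀ ℤ, sigmaD n y = sigmaD n x → etaLen u w y = etaLen u w x → absLexLE x y)

lemma sigmaD_add (n : ℕ) (x y : ℕ →₀ ℤ) : sigmaD n (x + y) = sigmaD n x + sigmaD n y := by
  unfold sigmaD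
  apply Finsupp.sum_add_index'
  · intro i; simp
  · intro i a b; ring

lemma sigmaD_single (n i : ℕ) (c : ℤ) : sigmaD n (Finsupp.single i c) = c * (n : ℤ) ^ i := by
  unfold sigmaD
  rw [Finsupp.sum_single_index]; simp

lemma l1D_single (i : ℕ) (c : ℤ) : l1D (Finsupp.single i c) = c.natAbs := by
  unfold l1D
  rw [Finsupp.sum_single_index]; simp

lemma supp_le (x : ℕ →₀ ℤ) (i : ℕ) (h : x i ≠ 0) : i ≤ kIdx x :=
  Finset.le_sup (f := id) (Finsupp.mem_support_iff.2 h)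

lemma kIdx_le (x : ℕ →₀ ℤ) (K : ℕ) (h : ∀ i, x i ≠ 0 → i ≤ K) : kIdx x ≤ K :=
  Finset.sup_le fun i hi => h i (Finsupp.mem_support_iff.1 hi)

lemma supp_sub (x : ℕ →₀ ℤ) (K : ℕ) (h : kIdx x < K) : x.support ⊆ Finset.range K := by
  intro i hi
  have := supp_le x i (Finsupp.mem_support_iff.1 hi)
  simp; omega

lemma sigmaD_range (n : ℕ) (x : ℕ →₀ ℤ) (K : ℕ) (h : kIdx x < K) :
    sigmaD n x = ∑ i ∈ Finset.range K, x i * (n : ℤ) ^ i := by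
  unfold sigmaD
  exact Finsupp.sum_of_support_subset _ (supp_sub x K h) _ (by simp)

lemma l1D_range (x : ℕ →₀ ℤ) (K : ℕ) (h : kIdx x < K) :
    l1D x = ∑ i ∈ Finset.range K, (x i).natAbs := by
  unfold l1D
  exact Finsupp.sum_of_support_subset _ (supp_sub x K h) _ (by simp)

lemma kIdx_add (x y : ℕ →₀ ℤ) : kIdx (x + y) ≤ max (kIdx x) (kIdx y) := by
  apply kIdx_le
  intro i hi
  by_cases h : x i = 0
  · have : y i ≠ 0 := by
      intro h'; apply hi; simp [h, h']
    exact le_max_of_le_right (supp_le y i this)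
  · exact le_max_of_le_left (supp_le x i h)

lemma kIdx_single (i : ℕ) (c : ℤ) : kIdx (Finsupp.single i c) ≤ i := by
  apply kIdx_le
  intro j hj
  by_contra hc
  apply hj
  rw [Finsupp.single_apply, if_neg]
  omega

lemma l1D_add (x y : ℕ →₀ ℤ) : l1D (x + y) ≤ l1D x + l1D y := by
  set K := max (kIdx x) (kIdx y) + 1 with hK
  have h := kIdx_add x y
  rw [l1D_range (x + y) K (by omega), l1D_range x K (by omega), l1D_range y K (by omega),
    ← Finset.sum_add_distrib]
  apply Finset.sum_le_sum
  intro i _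
  exact Int.natAbs_add_le _ _

lemma carry_one (n : ℕ) (hn : 2 ≤ n) (y : ℕ →₀ ℤ) (v : ℤ) (h : sigmaD n y = v * n) :
    ∃ y', sigmaD n y' = v ∧ l1D y' ≤ l1D y ∧ kIdx y' ≤ kIdx y - 1 := by
  set tl : ℕ →₀ ℤ := Finsupp.comapDomain (· + 1) y (fun a _ b _ h => Nat.succ_injective h) with htl
  have hap : ∀ i, tl i = y (i + 1) := fun i => rfl
  have hk : kIdx tl ≤ kIdx y - 1 := by
    apply kIdx_le
    intro i hi
    rw [hap] at hi
    have := supp_le y _ hi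
    omega
  have hs : sigmaD n y = n * sigmaD n tl + y 0 := by
    rw [sigmaD_range n y (kIdx y + 1 + 1) (by omega), sigmaD_range n tl (kIdx y + 1) (by omega),
      Finset.sum_range_succ', Finset.mul_sum]
    simp only [hap, pow_succ, pow_zero, mul_one]
    congr 1
    apply Finset.sum_congr rfl
    intro i _
    ring
  have hl : l1D y = l1D tl + (y 0).natAbs := by
    rw [l1D_range y (kIdx y + 1 + 1) (by omega), l1D_range tl (kIdx y + 1) (by omega),
      Finset.sum_range_succ']
    simp only [hap]
  have hd : y 0 = n * (v - sigmaD n tl) := by linarith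
  refine ⟨tl + Finsupp.single 0 (v - sigmaD n tl), ?_, ?_, ?_⟩
  · rw [sigmaD_add, sigmaD_single]; simp
  · refine (l1D_add _ _).trans ?_
    rw [l1D_single, hl, hd, Int.natAbs_mul, Int.natAbs_natCast]
    nlinarith [Nat.zero_le (v - sigmaD n tl).natAbs]
  · have := kIdx_add tl (Finsupp.single 0 (v - sigmaD n tl))
    have := kIdx_single 0 (v - sigmaD n tl)
    omega

lemma carry (n : ℕ) (hn : 2 ≤ n) (d : ℕ) : ∀ (y : ℕ →₀ ℤ) (v : ℤ), sigmaD n y = v * n ^ d →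
    ∃ y', sigmaD n y' = v ∧ l1D y' ≤ l1D y ∧ kIdx y' ≤ kIdx y - d := by
  induction d with
  | zero => intro y v h; exact ⟨y, by simpa using h, le_rfl, by omega⟩
  | succ d ih =>
    intro y v h
    obtain ⟨y1, h1, h2, h3⟩ := carry_one n hn y (v * n ^ d) (by rw [h]; ring)
    obtain ⟨y2, h4, h5, h6⟩ := ih y1 v h1
    exact ⟨y2, h4, h5.trans h2, by omega⟩

/-! Upper bound -/

def HasLen (n : ℕ) (g : BS n) (N : ℕ) : Prop :=
  ∃ wd : List Letter, evalWord n wd = g ∧ wd.length = N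

lemma HasLen.mul {n : ℕ} {g h : BS n} {N M : ℕ} (hg : HasLen n g N) (hh : HasLen n h M) :
    HasLen n (g * h) (N + M) := by
  obtain ⟨w1, h1, h2⟩ := hg
  obtain ⟨w2, h3, h4⟩ := hh
  exact ⟨w1 ++ w2, by simp [evalWord, ← h1, ← h3], by simp [h2, h4]⟩

lemma HasLen.letters (n : ℕ) (l : Letter) (k : ℕ) : HasLen n (evalLetter n l ^ k) k :=
  ⟨List.replicate k l, by simp [evalWord], by simp⟩

lemma HasLen.aPow (n : ℕ) (z : ℤ) : HasLen n (bsA n ^ z) z.natAbs := by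
  obtain ⟨m, rfl | rfl⟩ := Int.eq_nat_or_neg z
  · have := HasLen.letters n (0, true) m
    rw [zpow_natCast]; simpa [evalLetter] using this
  · have := HasLen.letters n (0, false) m
    rw [zpow_neg, zpow_natCast]; simpa [evalLetter] using this

lemma HasLen.tPow (n : ℕ) (z : ℤ) : HasLen n (bsT n ^ z) z.natAbs := by
  obtain ⟨m, rfl | rfl⟩ := Int.eq_nat_or_neg z
  · have := HasLen.letters n (1, true) m
    rw [zpow_natCast]; simpa [evalLetter] using this
  · have := HasLen.letters n (1, false) m
    rw [zpow_neg, zpow_natCast]; simpa [evalLetter] using this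

lemma bs_rel (n : ℕ) : bsT n * bsA n * (bsT n)⁻¹ = bsA n ^ n := by
  have h : PresentedGroup.mk (bsRels n)
      (FreeGroup.of 1 * FreeGroup.of 0 * (FreeGroup.of 1)⁻¹ * (FreeGroup.of 0 ^ n)⁻¹) = 1 :=
    PresentedGroup.one_of_mem (Set.mem_singleton _)
  simp only [map_mul, map_inv, map_pow] at h
  exact mul_inv_eq_one.1 h

lemma bs_comm (n : ℕ) (z : ℤ) : bsT n * bsA n ^ z = bsA n ^ (z * n) * bsT n := by
  have h : bsT n * bsA n ^ z * (bsT n)⁻¹ = (bsT n * bsA n * (bsT n)⁻¹) ^ z := by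
    rw [conj_zpow]
  rw [bs_rel, ← zpow_natCast, ← zpow_mul, mul_comm] at h
  rw [← h]; group

lemma bs_comm_pow (n k : ℕ) (z : ℤ) : bsT n ^ k * bsA n ^ z = bsA n ^ (z * (n : ℤ) ^ k) * bsT n ^ k := by
  induction k generalizing z with
  | zero => simp
  | succ k ih =>
    rw [pow_succ, mul_assoc, bs_comm, ← mul_assoc, ih, mul_assoc, ← pow_succ]
    congr 2; ring

lemma up_word (n : ℕ) (f : ℕ → ℤ) (k : ℕ) :
    HasLen n (bsA n ^ (∑ i ∈ Finset.range (k + 1), f i * (n : ℤ) ^ i) * bsT n ^ k)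
      (∑ i ∈ Finset.range (k + 1), (f i).natAbs + k) := by
  induction k with
  | zero => simpa using HasLen.aPow n (f 0)
  | succ k ih =>
    have h1 := (ih.mul (HasLen.tPow n 1)).mul (HasLen.aPow n (f (k + 1)))
    rw [Finset.sum_range_succ _ (k + 1), Finset.sum_range_succ _ (k + 1)]
    convert h1 using 1
    · rw [zpow_one, zpow_add, mul_assoc, ← bs_comm_pow]
      simp only [pow_succ, mul_assoc]
    · simp; ring

lemma down_word (n : ℕ) (f : ℕ → ℤ) (k : ℕ) :
    HasLen n ((bsT n ^ k)⁻¹ * bsA n ^ (∑ i ∈ Finset.range (k + 1), f i * (n : ℤ) ^ i))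
      (∑ i ∈ Finset.range (k + 1), (f i).natAbs + k) := by
  induction k with
  | zero => simpa using HasLen.aPow n (f 0)
  | succ k ih =>
    have h1 := ((HasLen.aPow n (f (k + 1))).mul (HasLen.tPow n (-1))).mul ih
    rw [Finset.sum_range_succ _ (k + 1), Finset.sum_range_succ _ (k + 1)]
    convert h1 using 1
    · rw [inv_mul_eq_iff_eq_mul, add_comm, zpow_add]
      have := bs_comm_pow n (k + 1) (f (k + 1))
      rw [← mul_assoc, ← mul_assoc, ← mul_assoc, this]
      congr 1
      rw [pow_succ']
      group
    · simp; ring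

lemma upper (n u w : ℕ) (x : ℕ →₀ ℤ) :
    HasLen n (bsT n ^ (-(u : ℤ)) * bsA n ^ (sigmaD n x) * bsT n ^ (w : ℤ)) (etaLen u w x) := by
  have hs := sigmaD_range n x (kIdx x + 1) (by omega)
  have hl := l1D_range x (kIdx x + 1) (by omega)
  unfold etaLen
  split_ifs
  · have h := up_word n x (kIdx x)
    rw [← hs, ← hl] at h
    convert ((HasLen.tPow n (-(u : ℤ))).mul h).mul (HasLen.tPow n ((w : ℤ) - kIdx x)) using 1
    · rw [← zpow_natCast _ (kIdx x)]
      group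
    · simp; ring
  · have h := down_word n x (kIdx x)
    rw [← hs, ← hl] at h
    convert ((HasLen.tPow n ((kIdx x : ℤ) - u)).mul h).mul (HasLen.tPow n (w : ℤ)) using 1
    · rw [← zpow_natCast _ (kIdx x)]
      group
    · simp; ring

/-! Lower bound -/

def permA : Equiv.Perm ℚ := Equiv.addRight 1

def permT (n : ℕ) (hn : 2 ≤ n) : Equiv.Perm ℚ :=
  Equiv.mulLeft₀ (n : ℚ) (by positivity)

lemma permA_pow (k : ℕ) (q : ℚ) : (permA ^ k) q = q + k := by
  induction k generalizing q with
  | zero => simp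
  | succ k ih => rw [pow_succ, Equiv.Perm.mul_apply, ih]; simp [permA]; ring

def bsGen (n : ℕ) (hn : 2 ≤ n) (i : Fin 2) : Equiv.Perm ℚ := if i = 0 then permA else permT n hn

lemma bsGen_rel (n : ℕ) (hn : 2 ≤ n) : ∀ r ∈ bsRels n, FreeGroup.lift (bsGen n hn) r = 1 := by
  intro r hr
  rw [bsRels, Set.mem_singleton_iff] at hr
  subst hr
  simp only [map_mul, map_inv, map_pow, FreeGroup.lift_apply_of]
  rw [mul_inv_eq_one, mul_inv_eq_iff_eq_mul]
  ext q
  simp only [Equiv.Perm.mul_apply, bsGen]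
  simp [permA_pow]
  simp [permA, permT]
  ring

def rep (n : ℕ) (hn : 2 ≤ n) : BS n →* Equiv.Perm ℚ := PresentedGroup.toGroup (bsGen_rel n hn)

lemma rep_A (n : ℕ) (hn : 2 ≤ n) (q : ℚ) : rep n hn (bsA n) q = q + 1 := by
  have : rep n hn (bsA n) = permA := PresentedGroup.toGroup.of (bsGen_rel n hn)
  rw [this]; rfl

lemma rep_T (n : ℕ) (hn : 2 ≤ n) (q : ℚ) : rep n hn (bsT n) q = n * q := by
  have : rep n hn (bsT n) = permT n hn := PresentedGroup.toGroup.of (bsGen_rel n hn)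
  rw [this]; rfl

lemma rep_A_inv (n : ℕ) (hn : 2 ≤ n) (q : ℚ) : rep n hn (bsA n)⁻¹ q = q - 1 := by
  rw [map_inv, Equiv.Perm.inv_eq_iff_eq, rep_A]; ring

lemma rep_T_inv (n : ℕ) (hn : 2 ≤ n) (q : ℚ) : rep n hn (bsT n)⁻¹ q = q / n := by
  have : (n : ℚ) ≠ 0 := by positivity
  rw [map_inv, Equiv.Perm.inv_eq_iff_eq, rep_T]; field_simp

lemma rep_A_zpow (n : ℕ) (hn : 2 ≤ n) (v : ℤ) (q : ℚ) : rep n hn (bsA n ^ v) q = q + v := by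
  induction v using Int.induction_on generalizing q with
  | zero => simp
  | succ k ih => rw [zpow_add_one, map_mul, Equiv.Perm.mul_apply, ih, rep_A]; push_cast; ring
  | pred k ih => rw [zpow_sub_one, map_mul, Equiv.Perm.mul_apply, ih, rep_A_inv]; push_cast; ring

lemma rep_T_zpow (n : ℕ) (hn : 2 ≤ n) (v : ℤ) (q : ℚ) :
    rep n hn (bsT n ^ v) q = (n : ℚ) ^ v * q := by
  have : (n : ℚ) ≠ 0 := by positivity
  induction v using Int.induction_on generalizing q with
  | zero => simp
  | succ k ih =>
    rw [zpow_add_one, map_mul, Equiv.Perm.mul_apply, ih, rep_T, zpow_add_one₀ this]; ring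
  | pred k ih =>
    rw [zpow_sub_one, map_mul, Equiv.Perm.mul_apply, ih, rep_T_inv, zpow_sub_one₀ this]; ring

lemma trace_word (n : ℕ) (hn : 2 ≤ n) (N : ℕ) (wd : List Letter) (hN : wd.length ≤ N) :
    ∃ (e lo hi : ℤ) (T : ℕ) (y : ℕ →₀ ℤ),
      (∀ q : ℚ, rep n hn (evalWord n wd) q = (n : ℚ) ^ e * q + (sigmaD n y : ℚ) / (n : ℚ) ^ N) ∧
      lo ≤ 0 ∧ 0 ≤ hi ∧ lo ≤ e ∧ e ≤ hi ∧ -(wd.length : ℤ) ≤ lo ∧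
      ((n : ℤ) ^ (lo + N).toNat ∣ sigmaD n y) ∧ (kIdx y : ℤ) ≤ hi + N ∧
      l1D y + T ≤ wd.length ∧
      (-lo + (hi - lo) + (hi - e) ≤ T ∨ hi + (hi - lo) + (e - lo) ≤ T) := by
  have hn0 : (n : ℚ) ≠ 0 := by positivity
  induction wd using List.reverseRecOn with
  | nil =>
    refine ⟨0, 0, 0, 0, 0, ?_, by simp, by simp, by simp, by simp, by simp, ?_, ?_, ?_, ?_⟩
    · intro q; simp [evalWord, sigmaD]
    · simp [sigmaD]
    · simp [kIdx]
    · simp [l1D]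
    · simp
  | append_singleton wd l ih =>
    rw [List.length_append, List.length_singleton] at hN
    obtain ⟨e, lo, hi, T, y, hq, h1, h2, h3, h4, h5, h6, h7, h8, h9⟩ := ih (by omega)
    have hev : ∀ q, rep n hn (evalWord n (wd ++ [l])) q
        = rep n hn (evalWord n wd) (rep n hn (evalLetter n l) q) := by
      intro q; simp [evalWord]
    have keyA : ∀ c : ℤ, c.natAbs = 1 → (∀ q, rep n hn (evalLetter n l) q = q + c) →
        ∃ (e lo hi : ℤ) (T : ℕ) (y : ℕ →₀ ℤ),
      (∀ q : ℚ, rep n hn (evalWord n (wd ++ [l])) q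
        = (n : ℚ) ^ e * q + (sigmaD n y : ℚ) / (n : ℚ) ^ N) ∧
      lo ≤ 0 ∧ 0 ≤ hi ∧ lo ≤ e ∧ e ≤ hi ∧ -((wd ++ [l]).length : ℤ) ≤ lo ∧
      ((n : ℤ) ^ (lo + N).toNat ∣ sigmaD n y) ∧ (kIdx y : ℤ) ≤ hi + N ∧
      l1D y + T ≤ (wd ++ [l]).length ∧
      (-lo + (hi - lo) + (hi - e) ≤ T ∨ hi + (hi - lo) + (e - lo) ≤ T) := by
      intro c hc hl
      refine ⟨e, lo, hi, T, y + Finsupp.single (e + N).toNat c, ?_, h1, h2, h3, h4, ?_, ?_, ?_, ?_,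
        h9⟩
      · intro q
        rw [hev, hl, hq, sigmaD_add, sigmaD_single]
        have : ((n : ℚ) ^ (e + N).toNat) = (n : ℚ) ^ e * (n : ℚ) ^ N := by
          rw [← zpow_natCast, ← zpow_natCast, ← zpow_add₀ hn0]
          congr 1; omega
        push_cast
        rw [this]; field_simp; ring
      · simp; omega
      · rw [sigmaD_add, sigmaD_single]
        refine dvd_add h6 (Dvd.dvd.mul_left (pow_dvd_pow _ (by omega)) _)
      · have := kIdx_add y (Finsupp.single (e + N).toNat c)
        have := kIdx_single (e + N).toNat c
        omega
      · have := l1D_add y (Finsupp.single (e + N).toNat c)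
        rw [l1D_single] at this
        simp; omega
    have keyT : ∀ c : ℤ, c.natAbs = 1 → (∀ q, rep n hn (evalLetter n l) q = (n : ℚ) ^ c * q) →
        ∃ (e lo hi : ℤ) (T : ℕ) (y : ℕ →₀ ℤ),
      (∀ q : ℚ, rep n hn (evalWord n (wd ++ [l])) q
        = (n : ℚ) ^ e * q + (sigmaD n y : ℚ) / (n : ℚ) ^ N) ∧
      lo ≤ 0 ∧ 0 ≤ hi ∧ lo ≤ e ∧ e ≤ hi ∧ -((wd ++ [l]).length : ℤ) ≤ lo ∧
      ((n : ℤ) ^ (lo + N).toNat ∣ sigmaD n y) ∧ (kIdx y : ℤ) ≤ hi + N ∧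
      l1D y + T ≤ (wd ++ [l]).length ∧
      (-lo + (hi - lo) + (hi - e) ≤ T ∨ hi + (hi - lo) + (e - lo) ≤ T) := by
      intro c hc hl
      refine ⟨e + c, min lo (e + c), max hi (e + c), T + 1, y, ?_, by omega, by omega, by omega,
        by omega, ?_, ?_, by omega, ?_, by omega⟩
      · intro q
        rw [hev, hl, hq, zpow_add₀ hn0]; ring
      · simp; omega
      · exact (pow_dvd_pow _ (by omega)).trans h6
      · simp; omega
    obtain ⟨i, b⟩ := l
    fin_cases i <;> cases b
    · exact keyA (-1) rfl (fun q => by simp [evalLetter, -map_inv, rep_A_inv]; ring)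
    · exact keyA 1 rfl (fun q => by simp [evalLetter, rep_A])
    · exact keyT (-1) rfl (fun q => by simp [evalLetter, -map_inv, rep_T_inv]; ring)
    · exact keyT 1 rfl (fun q => by simp [evalLetter, rep_T])

lemma lower (n : ℕ) (hn : 2 ≤ n) (u w : ℕ) (v : ℤ)
    (hnf : (n : ℤ) ∣ v → u * w = 0) (wd : List Letter)
    (hwd : evalWord n wd = bsT n ^ (-(u : ℤ)) * bsA n ^ v * bsT n ^ (w : ℤ)) :
    ∃ y, sigmaD n y = v ∧ etaLen u w y ≤ wd.length := by
  have hn0 : (n : ℚ) ≠ 0 := by positivity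
  have hnz : (n : ℤ) ≠ 0 := by positivity
  obtain ⟨e, lo, hi, T, y, hq, h1, h2, h3, h4, h5, h6, h7, h8, h9⟩ :=
    trace_word n hn (wd.length + u) wd (by omega)
  set N := wd.length + u with hN
  have hr : ∀ q : ℚ, (n : ℚ) ^ (-(u : ℤ)) * ((n : ℚ) ^ (w : ℤ) * q + v)
      = (n : ℚ) ^ e * q + (sigmaD n y : ℚ) / (n : ℚ) ^ N := by
    intro q
    rw [← hq, hwd, map_mul, map_mul, Equiv.Perm.mul_apply, Equiv.Perm.mul_apply, rep_T_zpow,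
      rep_T_zpow, rep_A_zpow]
  have hr0 := hr 0
  have hr1 := hr 1
  have he : e = (w : ℤ) - u := by
    have h : (n : ℚ) ^ e = (n : ℚ) ^ ((w : ℤ) - u) := by
      rw [sub_eq_neg_add, zpow_add₀ hn0]; linarith
    have hn1 : (1 : ℚ) < n := by exact_mod_cast (by omega : 1 < n)
    exact zpow_right_injective₀ (by linarith) hn1.ne' h
  have hs : sigmaD n y = v * (n : ℤ) ^ wd.length := by
    have : (sigmaD n y : ℚ) = v * (n : ℚ) ^ wd.length := by
      simp only [mul_zero, zero_add] at hr0
      rw [zpow_neg, zpow_natCast, hN, pow_add] at hr0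
      field_simp at hr0
      linarith
    exact_mod_cast this
  have hlo : lo ≤ -(u : ℤ) := by
    by_contra hc
    push Not at hc
    have hdv : (n : ℤ) ∣ v := by
      have h : (n : ℤ) ^ (wd.length + 1) ∣ sigmaD n y := (pow_dvd_pow _ (by omega)).trans h6
      rw [hs, pow_succ, mul_comm v] at h
      exact (mul_dvd_mul_iff_left (pow_ne_zero _ hnz)).1 h
    rcases Nat.mul_eq_zero.1 (hnf hdv) with h | h <;> omega
  obtain ⟨y', g1, g2, g3⟩ := carry n hn wd.length y v hs
  refine ⟨y', g1, ?_⟩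
  unfold etaLen
  split_ifs <;> omega

/-- If `x ∈ L_v` minimizes `|η_{u,v,w}(·)|` over `L_v`, then `η_{u,v,w}(x)` is geodesic:
the word length of `t^{-u} a^v t^w` in `BS(1,n)` equals `|η_{u,v,w}(x)|`. -/
theorem minimal_is_geodesic (n : ℕ) (hn : 2 ≤ n) (u w : ℕ) (v : ℤ) (hv : v ≠ 0)
    (hnf : (n : ℤ) ∣ v → u * w = 0) (x : ℕ →₀ ℤ) (hxv : sigmaD n x = v)
    (hmin : ∀ y : ℕ →₀ ℤ, sigmaD n y = v → etaLen u w x ≤ etaLen u w y) :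
    wordLength n (bsT n ^ (-(u : ℤ)) * bsA n ^ v * bsT n ^ (w : ℤ)) = etaLen u w x := by
  have hne : HasLen n (bsT n ^ (-(u : ℤ)) * bsA n ^ v * bsT n ^ (w : ℤ)) (etaLen u w x) := by
    rw [← hxv]; exact upper n u w x
  apply le_antisymm
  · exact Nat.sInf_le hne
  · obtain ⟨wd, hwd, hlen⟩ := Nat.sInf_mem (s := {N : ℕ | ∃ wd : List Letter,
      evalWord n wd = bsT n ^ (-(u : ℤ)) * bsA n ^ v * bsT n ^ (w : ℤ) ∧ wd.length = N}) ⟨_, hne⟩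
    obtain ⟨y, hy, hle⟩ := lower n hn u w v hnf wd hwd
    exact (hmin y hy).trans (hle.trans hlen.le)
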